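/- arXiv:2602.03475 — 3 statements merged into one kernel-verified Lean document; each statement's English description precedes it below -/
import Mathlib

section
/- Let R be a semiprime (resp. prime) ring, σ a type, T an additive submonoid of the free abelian group (σ →₀ ℤ), and A = AddMonoidAlgebra R T. Then R is left Goldie if and only if A is left Goldie; and in that case A is semiprime (resp. prime) and udim(A) = udim(R) (left uniform dimensions). -/
universe u v

section ModuleDefs

variable {R : Type u} [Ring R] {M : Type v} [AddCommGroup M] [Module R M]

/-- `N` is an essential submodule of `M`: it meets every nonzero submodule nontrivially. -/
def IsEssentialSubmodule (N : Submodule R M) : Prop :=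
  ∀ K : Submodule R M, K ≠ ⊥ → N ⊓ K ≠ ⊥

/-- `N` is an essential submodule of `P`: `N ≤ P` and `N` meets every nonzero submodule
contained in `P` nontrivially. -/
def IsEssentialIn (N P : Submodule R M) : Prop :=
  N ≤ P ∧ ∀ K : Submodule R M, K ≤ P → K ≠ ⊥ → N ⊓ K ≠ ⊥

/-- `U` is a uniform submodule: `U ≠ ⊥` and any two nonzero submodules contained in `U`
intersect nontrivially. -/
def IsUniformSubmodule (U : Submodule R M) : Prop :=
  U ≠ ⊥ ∧ ∀ K L : Submodule R M, K ≤ U → L ≤ U → K ≠ ⊥ → L ≠ ⊥ → K ⊓ L ≠ ⊥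

end ModuleDefs

/-- The uniform (Goldie) dimension of a module: the supremum of the cardinals `#ι` over all
independent families `(f i)_{i : ι}` of nonzero submodules. -/
noncomputable def udim (R : Type u) (M : Type v) [Ring R] [AddCommGroup M] [Module R M] :
    Cardinal.{v} :=
  sSup { c : Cardinal.{v} | ∃ (ι : Type v) (f : ι → Submodule R M),
    iSupIndep f ∧ (∀ i, f i ≠ ⊥) ∧ c = Cardinal.mk ι }

/-- A ring has enough uniform left ideals if every nonzero left ideal contains a uniform
left ideal. -/
def HasEnoughUniformLeftIdeals (T : Type u) [Ring T] : Prop :=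
  ∀ L : Ideal T, L ≠ ⊥ → ∃ U : Ideal T, U ≤ L ∧ IsUniformSubmodule U

/-- The left annihilator of an element, as a left ideal. -/
def lAnn (T : Type u) [Ring T] (x : T) : Ideal T where
  carrier := {t | t * x = 0}
  add_mem' := by
    intro a b ha hb
    simp only [Set.mem_setOf_eq] at *
    rw [add_mul, ha, hb, add_zero]
  zero_mem' := by simp
  smul_mem' := by
    intro c t ht
    simp only [smul_eq_mul, Set.mem_setOf_eq] at *
    rw [mul_assoc, ht, mul_zero]

/-- The left singular ideal of a ring, as a set: the elements whose left annihilator is an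
essential left ideal. -/
def singSet (T : Type u) [Ring T] : Set T := {x | IsEssentialSubmodule (lAnn T x)}

/-- The left annihilator of a set, as a left ideal. -/
def lAnnSet (T : Type u) [Ring T] (U : Set T) : Ideal T where
  carrier := {t | ∀ u ∈ U, t * u = 0}
  add_mem' := by
    intro a b ha hb u hu
    rw [add_mul, ha u hu, hb u hu, add_zero]
  zero_mem' := by intro u hu; simp
  smul_mem' := by
    intro c t ht u hu
    simp only [smul_eq_mul]
    rw [mul_assoc, ht u hu, mul_zero]

/-- The ascending chain condition on left annihilators. -/
def ACCLeftAnnihilators (T : Type u) [Ring T] : Prop :=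
  ∀ f : ℕ → Ideal T, (∀ n, ∃ U : Set T, f n = lAnnSet T U) → Monotone f →
    ∃ n, ∀ m, n ≤ m → f m = f n

/-- A ring is left Goldie if it has finite left uniform dimension (no infinite independent
family of nonzero left ideals) and the ACC on left annihilators. -/
def IsLeftGoldie (T : Type u) [Ring T] : Prop :=
  (¬ ∃ f : ℕ → Ideal T, iSupIndep f ∧ ∀ n, f n ≠ ⊥) ∧ ACCLeftAnnihilators T

/-- A ring is prime: `I·J = 0` forces `I = 0` or `J = 0` for two-sided ideals. -/
def IsPrimeRing (T : Type u) [Ring T] : Prop :=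
  ∀ I J : TwoSidedIdeal T, (∀ x ∈ I, ∀ y ∈ J, x * y = 0) → I = ⊥ ∨ J = ⊥

/-- A ring is semiprime: `I·I = 0` forces `I = 0` for two-sided ideals. -/
def IsSemiprimeRing (T : Type u) [Ring T] : Prop :=
  ∀ I : TwoSidedIdeal T, (∀ x ∈ I, ∀ y ∈ I, x * y = 0) → I = ⊥

section Subring

variable {S : Type u} [Ring S]

/-- A subring `A` of `S`, viewed as a left `A`-submodule of `S`. -/
def Subring.selfSubmodule (A : Subring S) : Submodule A S where
  carrier := A
  add_mem' := by intro a b ha hb; exact add_mem ha hb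
  zero_mem' := zero_mem _
  smul_mem' := by intro a x hx; exact mul_mem a.2 hx

/-- `A` is a nicely essential subring of `S`. -/
def Subring.NicelyEssential (A : Subring S) : Prop :=
  ∀ E : Finset S, (∀ x ∈ E, x ≠ 0) → ∃ a ∈ A, ∀ x ∈ E, a * x ∈ A ∧ a * x ≠ 0

/-- `A` is a strongly nicely essential subring of `S`. -/
def Subring.StronglyNicelyEssential (A : Subring S) : Prop :=
  A.NicelyEssential ∧ ∀ x : S, ∃ c ∈ A, c * x ∈ A ∧ ∀ b ∈ A, b * c = 0 → b = 0

/-- The left annihilator in the subring `A` of an element `x` of the ambient ring,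
as a left ideal of `A`. -/
def Subring.lAnnIn (A : Subring S) (x : S) : Ideal A where
  carrier := {b | (b : S) * x = 0}
  add_mem' := by
    intro a b ha hb
    simp only [Set.mem_setOf_eq] at *
    push_cast
    rw [add_mul, ha, hb, add_zero]
  zero_mem' := by simp
  smul_mem' := by
    intro c t ht
    simp only [smul_eq_mul, Set.mem_setOf_eq] at *
    push_cast
    rw [mul_assoc, ht, mul_zero]

end Subring

section ModuleTheory

variable {R : Type u} [Ring R] {M : Type v} [AddCommGroup M] [Module R M]

/-- A finite family of nonzero vectors generating an independent family of cyclic submodules. -/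
def IndepCyclic (R : Type u) [Ring R] {M : Type v} [AddCommGroup M] [Module R M]
    {ι : Type*} [Fintype ι] (v : ι → M) : Prop :=
  (∀ i, v i ≠ 0) ∧ ∀ r : ι → R, ∑ i, r i • v i = 0 → ∀ i, r i • v i = 0

/-- Every finite independent family of nonzero cyclic submodules of `P` has at most `n`
members. -/
def UdimLE (P : Submodule R M) (n : ℕ) : Prop :=
  ∀ (m : ℕ) (v : Fin m → M), (∀ i, v i ∈ P) → IndepCyclic R v → m ≤ n

theorem IndepCyclic.comp {ι κ : Type*} [Fintype ι] [Fintype κ] {v : ι → M}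
    (h : IndepCyclic R v) {e : κ → ι} (he : Function.Injective e) :
    IndepCyclic R (v ∘ e) := by
  classical
  refine ⟨fun i => h.1 _, fun r hr i => ?_⟩
  have key : ∀ j, Function.extend e r 0 (e j) = r j := fun j => he.extend_apply r 0 j
  have := h.2 (Function.extend e r 0) ?_ (e i)
  · rwa [key] at this
  · rw [← hr, ← Finset.sum_subset (Finset.subset_univ (Finset.univ.image e)),
      Finset.sum_image he.injOn]
    · simp [key]
    · intro j _ hj
      rw [Function.extend_apply']
      · simp
      · simpa using hj

theorem UdimLE.card_le {P : Submodule R M} {n : ℕ} (h : UdimLE P n) {ι : Type*} [Fintype ι]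
    {v : ι → M} (hP : ∀ i, v i ∈ P) (hv : IndepCyclic R v) : Fintype.card ι ≤ n :=
  h _ (v ∘ (Fintype.equivFin ι).symm) (fun _ => hP _) (hv.comp (Equiv.injective _))

theorem IndepCyclic.smul {ι : Type*} [Fintype ι] {v : ι → M}
    (h : IndepCyclic R v) {r : ι → R} (hr : ∀ i, r i • v i ≠ 0) :
    IndepCyclic R (fun i => r i • v i) := by
  refine ⟨hr, fun s hs i => ?_⟩
  simp only [smul_smul] at hs ⊢
  exact h.2 _ hs i

theorem IndepCyclic.exists_split {ι : Type*} [Fintype ι] [DecidableEq ι] {v : ι → M}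
    (h : IndepCyclic R v) (K : Submodule R M) :
    ∃ J : Finset ι, (∀ r : ι → R, ∑ j ∈ J, r j • v j ∈ K → ∀ j ∈ J, r j • v j = 0) ∧
      ∃ k : {i // i ∉ J} → M, (∀ i, k i ∈ K) ∧ IndepCyclic R k := by
  obtain ⟨J, hJ⟩ := (Set.toFinite {J : Finset ι |
    ∀ r : ι → R, ∑ j ∈ J, r j • v j ∈ K → ∀ j ∈ J, r j • v j = 0}).exists_maximal
    ⟨∅, by simp⟩
  refine ⟨J, hJ.1, ?_⟩
  have key : ∀ i : {i // i ∉ J}, ∃ r : ι → R, (∀ j ∉ J, j ≠ i → r j = 0) ∧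
      ∑ j, r j • v j ∈ K ∧ r i • v i ≠ 0 := by
    rintro ⟨i, hi⟩
    by_contra! H
    have hmem : insert i J ∈ {J : Finset ι |
        ∀ r : ι → R, ∑ j ∈ J, r j • v j ∈ K → ∀ j ∈ J, r j • v j = 0} := by
      intro r hr
      have hi0 : r i • v i = 0 := by
        have := H (fun j => if j ∈ insert i J then r j else 0) ?_ ?_
        · simpa using this
        · intro j hj hji
          simp [hj, hji]
        · simpa only [ite_smul, zero_smul, Finset.sum_ite_mem, Finset.univ_inter] using hr
      rw [Finset.sum_insert hi, hi0, zero_add] at hr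
      intro j hj
      rcases Finset.mem_insert.1 hj with rfl | hj
      · exact hi0
      · exact hJ.1 r hr j hj
    exact hi (hJ.2 hmem (Finset.subset_insert i J) (Finset.mem_insert_self i J))
  choose r hr0 hrK hri using key
  refine ⟨fun i => ∑ j, r i j • v j, hrK, fun i hi => hri i (h.2 _ hi i), fun s hs => ?_⟩
  have hsum : ∑ j, (∑ i, s i * r i j) • v j = 0 := by
    rw [← hs]
    simp only [Finset.smul_sum, Finset.sum_smul, smul_smul]
    exact Finset.sum_comm
  have h1 := h.2 _ hsum
  have h2 : ∀ i : {i // i ∉ J}, (s i * r i i) • v i = 0 := by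
    intro i
    have := h1 i
    rwa [Finset.sum_eq_single i (fun i' _ hne => by
      rw [hr0 i' i i.2 (fun e => hne (Subtype.ext e.symm)), mul_zero]) (by simp)] at this
  intro i
  have hs' : s i • ∑ j, r i j • v j = ∑ j ∈ J, (s i * r i j) • v j := by
    rw [Finset.smul_sum, ← Finset.sum_subset (Finset.subset_univ J)]
    · simp only [smul_smul]
    · intro j _ hj
      rw [smul_smul]
      by_cases hji : j = i
      · rw [hji, h2]
      · rw [hr0 i j hj hji, mul_zero, zero_smul]
  rw [hs']
  exact Finset.sum_eq_zero (hJ.1 (fun j => s i * r i j) (hs' ▸ K.smul_mem _ (hrK i)))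

theorem Fintype.card_le_of_finset_add {ι : Type*} [Fintype ι] [DecidableEq ι] (J : Finset ι)
    {a b : ℕ} (ha : Fintype.card {i // i ∈ J} ≤ a) (hb : Fintype.card {i // i ∉ J} ≤ b) :
    Fintype.card ι ≤ a + b := by
  have := Fintype.card_subtype_compl (· ∈ J)
  omega

theorem UdimLE.add_of_maximal_disjoint {P A B : Submodule R M} {p n : ℕ}
    (hA : UdimLE A p) (hB : UdimLE B n) (hBP : B ≤ P) (hAB : Disjoint A B)
    (hmax : ∀ C ≤ P, B ≤ C → Disjoint A C → C ≤ B) : UdimLE P (p + n) := by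
  intro m v hvP hv
  obtain ⟨J, hJ, k, hk, hki⟩ := hv.exists_split B
  rw [← Fintype.card_fin m]
  refine Fintype.card_le_of_finset_add J ?_ (hB.card_le hk hki)
  have hJ' : ∀ r : J → R, ∑ j, r j • v j ∈ B → ∀ j, r j • v j = 0 := by
    intro r hr j
    have := hJ (fun i => if h : i ∈ J then r ⟨i, h⟩ else 0) ?_ j j.2
    · simpa using this
    · rw [← Finset.sum_coe_sort]
      simpa using hr
  have key : ∀ j : J, ∃ a ∈ A, a ≠ 0 ∧ ∃ b ∈ B, ∃ r : R, a = b + r • v j := by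
    intro j
    by_contra! H
    have hvj : v j ∈ B := by
      refine hmax (B ⊔ Submodule.span R {v j})
        (sup_le hBP ((Submodule.span_singleton_le_iff_mem _ _).2 (hvP j))) le_sup_left ?_
        (Submodule.mem_sup_right (Submodule.mem_span_singleton_self _))
      rw [Submodule.disjoint_def]
      intro a ha ha'
      obtain ⟨b, hb, c, hc, rfl⟩ := Submodule.mem_sup.1 ha'
      obtain ⟨r, rfl⟩ := Submodule.mem_span_singleton.1 hc
      by_contra h0
      exact H _ ha h0 b hb r rfl
    have := hJ' (Pi.single j 1) (by
      rw [Finset.sum_eq_single j (fun i _ hij => by simp [Pi.single_eq_of_ne hij]) (by simp)]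
      simpa using hvj) j
    exact hv.1 j (by simpa using this)
  choose a haA ha0 b hbB r hab using key
  refine hA.card_le haA ⟨ha0, fun s hs => ?_⟩
  have h1 : ∀ j, (s j * r j) • v j = 0 := by
    apply hJ'
    have : ∑ j, (s j * r j) • v j = - ∑ j, s j • b j := by
      rw [eq_neg_iff_add_eq_zero, ← hs, ← Finset.sum_add_distrib]
      exact Finset.sum_congr rfl fun j _ => by rw [hab, smul_add, smul_smul, add_comm]
    rw [this]
    exact B.neg_mem (B.sum_mem fun j _ => B.smul_mem _ (hbB j))
  intro j
  have h2 : s j • a j = s j • b j := by rw [hab, smul_add, smul_smul, h1, add_zero]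
  exact Submodule.disjoint_def.1 hAB _ (A.smul_mem _ (haA j)) (h2 ▸ B.smul_mem _ (hbB j))

theorem iSupIndep_of_disjoint_of_forall_lt_le {ι : Type*} [LinearOrder ι]
    {f L : ι → Submodule R M} (hle : ∀ i j, i < j → f i ≤ L j)
    (hdisj : ∀ j, Disjoint (f j) (L j)) : iSupIndep f := by
  classical
  rw [iSupIndep_iff_finsetSum_eq_zero_imp_eq_zero]
  intro s v hv hs
  by_contra! H
  obtain ⟨j, hj, hmax⟩ := (s.filter (v · ≠ 0)).exists_max_image id (by
    obtain ⟨i, hi, h0⟩ := H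
    exact ⟨i, by simp [hi, h0]⟩)
  rw [Finset.mem_filter] at hj
  refine hj.2 (Submodule.disjoint_def.1 (hdisj j) _ (hv j hj.1) ?_)
  rw [← Finset.add_sum_erase s v hj.1] at hs
  rw [eq_neg_of_add_eq_zero_left hs]
  refine (L j).neg_mem ((L j).sum_mem fun i hi => ?_)
  rw [Finset.mem_erase] at hi
  by_cases h0 : v i = 0
  · rw [h0]; exact zero_mem _
  · exact hle i j (lt_of_le_of_ne (hmax i (by simp [hi.2, h0])) hi.1) (hv i hi.2)

theorem exists_maximal_disjoint_le {P A B : Submodule R M} (hBP : B ≤ P) (hAB : Disjoint A B) :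
    ∃ C, B ≤ C ∧ C ≤ P ∧ Disjoint A C ∧ ∀ D ≤ P, C ≤ D → Disjoint A D → D ≤ C := by
  obtain ⟨C, hBC, hC⟩ := zorn_le_nonempty₀ {C : Submodule R M | C ≤ P ∧ Disjoint A C}
    (fun c hc hch y hy => ⟨sSup c, ⟨sSup_le fun z hz => (hc hz).1,
      hch.directedOn.disjoint_sSup_right.2 fun z hz => (hc hz).2⟩, fun z hz => le_sSup hz⟩)
    B ⟨hBP, hAB⟩
  exact ⟨C, hBC, hC.1.1, hC.1.2, fun D hD hCD hAD => hC.2 ⟨hD, hAD⟩ hCD⟩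

theorem exists_disjoint_of_forall_not_udimLE {P : Submodule R M} (hP : ∀ n, ¬ UdimLE P n) :
    ∃ C D : Submodule R M, C ≤ P ∧ D ≤ P ∧ C ≠ ⊥ ∧ Disjoint C D ∧ ∀ n, ¬ UdimLE D n := by
  have h1 := hP 1
  simp only [UdimLE, not_forall, not_le] at h1
  obtain ⟨m, v, hvP, hv, hm⟩ := h1
  let i : Fin m := ⟨0, by omega⟩
  let j : Fin m := ⟨1, hm⟩
  have hij : i ≠ j := by simp [i, j]
  have hspan : ∀ i, Submodule.span R {v i} ≤ P := fun i =>
    (Submodule.span_singleton_le_iff_mem _ _).2 (hvP i)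
  have hne : ∀ i, Submodule.span R {v i} ≠ ⊥ := fun i => by
    simpa [Submodule.span_singleton_eq_bot] using hv.1 i
  have hdisj : Disjoint (Submodule.span R {v i}) (Submodule.span R {v j}) := by
    rw [Submodule.disjoint_def]
    intro x hx hx'
    obtain ⟨r, rfl⟩ := Submodule.mem_span_singleton.1 hx
    obtain ⟨s, hs⟩ := Submodule.mem_span_singleton.1 hx'
    have := hv.2 (Pi.single i r - Pi.single j s) (by
      simp [sub_smul, Finset.sum_sub_distrib, Pi.single_apply, ite_smul, hs]) i
    simpa [hij] using this
  obtain ⟨C, hC, hCP, hAC, hmax⟩ := exists_maximal_disjoint_le (hspan j) hdisj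
  by_cases hCu : ∀ n, ¬ UdimLE C n
  · exact ⟨_, C, hspan i, hCP, hne i, hAC, hCu⟩
  · push Not at hCu
    obtain ⟨n, hn⟩ := hCu
    refine ⟨C, _, hCP, hspan i, ?_, hAC.symm, fun p hp =>
      hP _ (hp.add_of_maximal_disjoint hn hCP hAC hmax)⟩
    rintro rfl
    exact hne j (le_bot_iff.1 hC)

theorem IndepCyclic.of_iSupIndep {ι : Type*} [Fintype ι] {f : ι → Submodule R M}
    (hf : iSupIndep f) {v : ι → M} (hv : ∀ i, v i ∈ f i) (h0 : ∀ i, v i ≠ 0) :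
    IndepCyclic R v :=
  ⟨h0, fun r hr i => (iSupIndep_iff_finsetSum_eq_zero_imp_eq_zero f).1 hf Finset.univ
    (fun i => r i • v i) (fun i _ => (f i).smul_mem _ (hv i)) hr i (Finset.mem_univ i)⟩

theorem IndepCyclic.iSupIndep {ι : Type*} [Fintype ι] {v : ι → M} (hv : IndepCyclic R v) :
    iSupIndep fun i => Submodule.span R {v i} := by
  classical
  rw [iSupIndep_iff_finsetSum_eq_zero_imp_eq_zero]
  intro s w hw hs
  choose! r hr using fun i hi => Submodule.mem_span_singleton.1 (hw i hi)
  intro i hi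
  have := hv.2 (fun i => if i ∈ s then r i else 0) (by
    simp only [ite_smul, zero_smul, Finset.sum_ite_mem, Finset.univ_inter]
    rw [← hs]
    exact Finset.sum_congr rfl hr) i
  rw [← hr i hi]
  simpa [hi] using this

theorem UdimLE.card_le_of_iSupIndep {n : ℕ} (h : UdimLE (⊤ : Submodule R M) n)
    {ι : Type*} [Fintype ι] {f : ι → Submodule R M} (hf : iSupIndep f) (h0 : ∀ i, f i ≠ ⊥) :
    Fintype.card ι ≤ n := by
  choose v hv hv0 using fun i => Submodule.exists_mem_ne_zero_of_ne_bot (h0 i)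
  exact h.card_le (fun _ => Submodule.mem_top) (IndepCyclic.of_iSupIndep hf hv hv0)

theorem UdimLE.not_exists_iSupIndep {n : ℕ} (h : UdimLE (⊤ : Submodule R M) n) :
    ¬ ∃ f : ℕ → Submodule R M, iSupIndep f ∧ ∀ i, f i ≠ ⊥ := by
  rintro ⟨f, hf, h0⟩
  have := h.card_le_of_iSupIndep (hf.comp (Fin.val_injective (n := n + 1))) fun i => h0 i
  simp at this

theorem exists_udimLE_of_not_exists_iSupIndep
    (h : ¬ ∃ f : ℕ → Submodule R M, iSupIndep f ∧ ∀ i, f i ≠ ⊥) :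
    ∃ n, UdimLE (⊤ : Submodule R M) n := by
  by_contra! H
  choose! C D hC hD hC0 hCD hDu using
    fun (P : Submodule R M) => exists_disjoint_of_forall_not_udimLE (P := P)
  let E : ℕ → Submodule R M := fun n => D^[n] ⊤
  have hE : ∀ n, E (n + 1) = D (E n) := fun n => Function.iterate_succ_apply' D n ⊤
  have hEu : ∀ n k, ¬ UdimLE (E n) k := by
    intro n
    induction n with
    | zero => exact H
    | succ n ih => rw [hE]; exact hDu _ ih
  have hanti : Antitone E := antitone_nat_of_succ_le fun n => hE n ▸ hD _ (hEu n)
  refine h ⟨fun n => C (E n), ?_, fun n => hC0 _ (hEu n)⟩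
  refine iSupIndep_of_disjoint_of_forall_lt_le (ι := ℕᵒᵈ)
    (f := fun n : ℕ => C (E n)) (L := fun n : ℕ => E (n + 1)) ?_ ?_
  · intro i j hij
    exact (hC _ (hEu i)).trans (hanti (Nat.succ_le_of_lt (OrderDual.toDual_lt_toDual.1 hij)))
  · intro j
    exact (hE j).symm ▸ hCD _ (hEu j)

theorem udim_eq_of_udimLE {n : ℕ} (h : UdimLE (⊤ : Submodule R M) n) {v : Fin n → M}
    (hv : IndepCyclic R v) : udim R M = n := by
  refine IsGreatest.csSup_eq ⟨?_, ?_⟩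
  · refine ⟨ULift (Fin n), fun i => Submodule.span R {v i.down}, ?_, fun i => ?_, by simp⟩
    · exact hv.iSupIndep.comp ULift.down_injective
    · simpa [Submodule.span_singleton_eq_bot] using hv.1 _
  · rintro c ⟨ι, f, hf, h0, rfl⟩
    rcases finite_or_infinite ι with hι | hι
    · have := Fintype.ofFinite ι
      rw [Cardinal.mk_fintype]
      exact_mod_cast h.card_le_of_iSupIndep hf h0
    · refine absurd ⟨f ∘ Infinite.natEmbedding ι, hf.comp (Infinite.natEmbedding ι).injective,
        fun i => h0 _⟩ h.not_exists_iSupIndep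

theorem UdimLE.exists_indepCyclic {n : ℕ} (h : UdimLE (⊤ : Submodule R M) n) :
    ∃ m, UdimLE (⊤ : Submodule R M) m ∧ ∃ v : Fin m → M, IndepCyclic R v := by
  classical
  have hex : ∃ n, UdimLE (⊤ : Submodule R M) n := ⟨n, h⟩
  refine ⟨Nat.find hex, Nat.find_spec hex, ?_⟩
  rcases hk : Nat.find hex with _ | k
  · exact ⟨fun i => 0, fun i => i.elim0, fun _ _ i => i.elim0⟩
  · have := Nat.find_min hex (m := k) (by omega)
    simp only [UdimLE, not_forall, not_le] at this
    obtain ⟨m, v, -, hv, hm⟩ := this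
    exact ⟨_, hv.comp (Fin.castLE_injective (Nat.succ_le_of_lt hm))⟩

end ModuleTheory

section RingTheory

variable {R : Type u} [Ring R]

theorem exists_twoSidedIdeal_mul_eq_zero {a b : R} (hab : ∀ r, a * r * b = 0) :
    ∃ I J : TwoSidedIdeal R, a ∈ I ∧ b ∈ J ∧ ∀ x ∈ I, ∀ y ∈ J, x * y = 0 := by
  let I : TwoSidedIdeal R := .mk' {x | ∀ r, x * r * b = 0} (by simp)
    (fun {x y} hx hy r => by rw [add_mul, add_mul, hx, hy, add_zero])
    (fun {x} hx r => by rw [neg_mul, neg_mul, hx, neg_zero])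
    (fun {x y} hy r => by rw [mul_assoc x, mul_assoc x, hy, mul_zero])
    (fun {x y} hx r => by rw [mul_assoc x, hx])
  let J : TwoSidedIdeal R := .mk' {y | ∀ x ∈ I, x * y = 0} (by simp)
    (fun {x y} hx hy z hz => by rw [mul_add, hx z hz, hy z hz, add_zero])
    (fun {x} hx z hz => by rw [mul_neg, hx z hz, neg_zero])
    (fun {x y} hy z hz => by rw [← mul_assoc, hy _ (I.mul_mem_right _ _ hz)])
    (fun {x y} hx z hz => by rw [← mul_assoc, hx z hz, zero_mul])
  have hI : ∀ x, x ∈ I ↔ ∀ r, x * r * b = 0 := fun x => TwoSidedIdeal.mem_mk' ..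
  have hJ : ∀ y, y ∈ J ↔ ∀ x ∈ I, x * y = 0 := fun x => TwoSidedIdeal.mem_mk' ..
  exact ⟨I, J, (hI a).2 hab, (hJ b).2 fun x hx => by simpa using (hI x).1 hx 1,
    fun x hx y hy => (hJ y).1 hy x hx⟩

theorem IsPrimeRing.eq_zero_or_eq_zero (h : IsPrimeRing R) {a b : R}
    (hab : ∀ r, a * r * b = 0) : a = 0 ∨ b = 0 := by
  obtain ⟨I, J, ha, hb, hIJ⟩ := exists_twoSidedIdeal_mul_eq_zero hab
  rcases h I J hIJ with rfl | rfl
  · exact .inl ((TwoSidedIdeal.mem_bot R).1 ha)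
  · exact .inr ((TwoSidedIdeal.mem_bot R).1 hb)

theorem IsSemiprimeRing.eq_zero (h : IsSemiprimeRing R) {a : R}
    (ha : ∀ r, a * r * a = 0) : a = 0 := by
  obtain ⟨I, J, haI, haJ, hIJ⟩ := exists_twoSidedIdeal_mul_eq_zero ha
  have e := h (I ⊓ J) fun x hx y hy =>
    hIJ x ((TwoSidedIdeal.mem_inf R).1 hx).1 y ((TwoSidedIdeal.mem_inf R).1 hy).2
  rw [← TwoSidedIdeal.mem_bot, ← e, TwoSidedIdeal.mem_inf]
  exact ⟨haI, haJ⟩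

theorem IsPrimeRing.isSemiprimeRing (h : IsPrimeRing R) : IsSemiprimeRing R :=
  fun I hI => or_self_iff.1 (h I I hI)

theorem mem_lAnn {a x : R} : a ∈ lAnn R x ↔ a * x = 0 := Iff.rfl

theorem mem_lAnnSet {a : R} {U : Set R} : a ∈ lAnnSet R U ↔ ∀ u ∈ U, a * u = 0 := Iff.rfl

theorem exists_mul_ne_zero_of_mem_singSet {a b : R} (ha : a ∈ singSet R) (hb : b ≠ 0) :
    ∃ r, r * b ≠ 0 ∧ r * b * a = 0 := by
  have := ha (Ideal.span {b}) (by simpa [Ideal.span_singleton_eq_bot] using hb)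
  obtain ⟨x, hx, hx0⟩ := Submodule.exists_mem_ne_zero_of_ne_bot this
  obtain ⟨r, rfl⟩ := Ideal.mem_span_singleton'.1 hx.2
  exact ⟨r, hx0, hx.1⟩

theorem mul_mem_singSet (y : R) {a : R} (ha : a ∈ singSet R) : y * a ∈ singSet R := by
  intro K hK
  obtain ⟨k, hk, hk0⟩ := Submodule.exists_mem_ne_zero_of_ne_bot hK
  rw [Submodule.ne_bot_iff]
  by_cases hky : k * y = 0
  · exact ⟨k, ⟨by rw [SetLike.mem_coe, mem_lAnn, ← mul_assoc, hky, zero_mul], hk⟩, hk0⟩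
  · obtain ⟨r, hr, hra⟩ := exists_mul_ne_zero_of_mem_singSet ha hky
    refine ⟨r * k, ⟨?_, K.smul_mem r hk⟩, fun h => hr ?_⟩
    · rw [SetLike.mem_coe, mem_lAnn, ← hra]
      simp only [mul_assoc]
    · rw [← mul_assoc, h, zero_mul]

theorem ACCLeftAnnihilators.exists_maximal (h : ACCLeftAnnihilators R) {S : Set R}
    (hS : S.Nonempty) : ∃ a ∈ S, ∀ b ∈ S, lAnn R a ≤ lAnn R b → lAnn R b ≤ lAnn R a := by
  have hwf : WellFoundedGT {I : Ideal R // ∃ U, I = lAnnSet R U} := by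
    rw [wellFoundedGT_iff_monotone_chain_condition]
    intro f
    obtain ⟨n, hn⟩ := h (fun k => (f k).1) (fun k => (f k).2) fun i j hij => f.monotone hij
    exact ⟨n, fun m hm => Subtype.ext (hn m hm).symm⟩
  let φ : R → {I : Ideal R // ∃ U, I = lAnnSet R U} :=
    fun a => ⟨lAnn R a, {a}, by ext; simp [mem_lAnn, mem_lAnnSet]⟩
  obtain ⟨_, ⟨a, ha, rfl⟩, hmax⟩ := hwf.wf.has_min (φ '' S) (hS.image φ)
  refine ⟨a, ha, fun b hb hab => ?_⟩
  by_contra hba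
  exact hmax _ ⟨b, hb, rfl⟩ (lt_of_le_not_ge hab hba)

theorem IsSemiprimeRing.singSet_eq_zero (hR : IsSemiprimeRing R) (h : ACCLeftAnnihilators R) :
    ∀ a ∈ singSet R, a = 0 := by
  by_contra! H
  obtain ⟨a, ⟨ha, ha0⟩, hmax⟩ := h.exists_maximal (S := {a | a ∈ singSet R ∧ a ≠ 0}) H
  refine ha0 (hR.eq_zero fun x => ?_)
  by_contra hx
  have hxa : a * x * a ∈ singSet R := mul_mem_singSet _ ha
  obtain ⟨r, hr, hr'⟩ := exists_mul_ne_zero_of_mem_singSet (mul_mem_singSet x ha) ha0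
  refine hr (hmax _ ⟨hxa, hx⟩ (fun t ht => ?_) ?_)
  · rw [mem_lAnn] at ht ⊢
    rw [← mul_assoc, ← mul_assoc, ht, zero_mul, zero_mul]
  · rw [mem_lAnn, ← hr']
    simp only [mul_assoc]

theorem accLeftAnnihilators_of_singSet (hsing : ∀ a ∈ singSet R, a = 0)
    (h : ¬ ∃ f : ℕ → Ideal R, iSupIndep f ∧ ∀ n, f n ≠ ⊥) : ACCLeftAnnihilators R := by
  intro f hf hmono
  by_contra! H
  have key : ∀ n, ∃ m, n ≤ m ∧ ∃ K : Ideal R, K ≤ f m ∧ K ≠ ⊥ ∧ Disjoint K (f n) := by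
    intro n
    obtain ⟨m, hnm, hne⟩ := H n
    refine ⟨m, hnm, ?_⟩
    obtain ⟨x, hxm, hxn⟩ := SetLike.exists_of_lt (lt_of_le_of_ne (hmono hnm) hne.symm)
    obtain ⟨U, hU⟩ := hf n
    rw [hU, mem_lAnnSet] at hxn
    push Not at hxn
    obtain ⟨u, huU, hxu⟩ := hxn
    have hns : x * u ∉ singSet R := fun hs => hxu (hsing _ hs)
    simp only [singSet, IsEssentialSubmodule, Set.mem_ofPred_eq, not_forall, not_not] at hns
    obtain ⟨K, hK, hKu⟩ := hns
    rw [← disjoint_iff, Submodule.disjoint_def] at hKu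
    refine ⟨K.map (LinearMap.toSpanSingleton R R x), ?_, ?_, ?_⟩
    · rintro _ ⟨k, -, rfl⟩
      exact (f m).mul_mem_left k hxm
    · obtain ⟨k, hk, hk0⟩ := Submodule.exists_mem_ne_zero_of_ne_bot hK
      rw [Submodule.ne_bot_iff]
      refine ⟨_, ⟨k, hk, rfl⟩, fun h0 => hk0 (hKu k ?_ hk)⟩
      simp only [LinearMap.toSpanSingleton_apply, smul_eq_mul] at h0
      rw [mem_lAnn, ← mul_assoc, h0, zero_mul]
    · rw [Submodule.disjoint_def]
      rintro _ ⟨k, hk, rfl⟩ hkn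
      rw [hU, mem_lAnnSet] at hkn
      have := hkn u huU
      simp only [LinearMap.toSpanSingleton_apply, smul_eq_mul] at this ⊢
      rw [hKu k (by rwa [mem_lAnn, ← mul_assoc]) hk, zero_mul]
  choose m hm K hKm hK0 hKn using key
  let N : ℕ → ℕ := fun k => m^[k] 0
  have hN : ∀ k, N (k + 1) = m (N k) := fun k => Function.iterate_succ_apply' m k 0
  have hNmono : Monotone N := monotone_nat_of_le_succ fun k => hN k ▸ hm _
  refine h ⟨fun k => K (N k), iSupIndep_of_disjoint_of_forall_lt_le
    (L := fun k => f (N k)) (fun i j hij => ?_) fun j => hKn _, fun k => hK0 _⟩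
  refine (hKm _).trans (hmono ?_)
  rw [← hN]
  exact hNmono hij

end RingTheory

theorem not_forall_mul_le_of_le_succ_pow {f : ℕ → ℕ} {m n d : ℕ} (hnm : n < m) (h0 : 1 ≤ f 0)
    (hf : ∀ k, f k ≤ (k + 1) ^ d) : ¬ ∀ k, m * f k ≤ n * f (k + 1) := by
  intro h
  have key : ∀ k, m ^ k ≤ n ^ k * f k := by
    intro k
    induction k with
    | zero => simpa using h0
    | succ k ih =>
      calc m ^ (k + 1) = m * m ^ k := pow_succ' m k
        _ ≤ m * (n ^ k * f k) := Nat.mul_le_mul_left _ ih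
        _ = n ^ k * (m * f k) := by ring
        _ ≤ n ^ k * (n * f (k + 1)) := Nat.mul_le_mul_left _ (h k)
        _ = n ^ (k + 1) * f (k + 1) := by ring
  rcases Nat.eq_zero_or_pos n with rfl | hn
  · have := key 1
    simp at this
    omega
  · have hn' : (0 : ℝ) < n := by exact_mod_cast hn
    have hr : (1 : ℝ) < m / n := by
      rw [one_lt_div hn']
      exact_mod_cast hnm
    have hr0 : (0 : ℝ) < m / n := by positivity
    have ht := (tendsto_pow_const_div_const_pow_of_one_lt d hr).comp
      (Filter.tendsto_add_atTop_nat 1)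
    obtain ⟨k, hk⟩ := (ht.eventually (gt_mem_nhds (inv_pos.2 hr0))).exists
    simp only [Function.comp_apply] at hk
    rw [div_lt_iff₀ (by positivity), pow_succ', ← mul_assoc, inv_mul_cancel₀ hr0.ne',
      one_mul, div_pow, lt_div_iff₀ (by positivity)] at hk
    have h1 : m ^ k ≤ n ^ k * (k + 1) ^ d := (key k).trans (Nat.mul_le_mul_left _ (hf k))
    have h2 : (m : ℝ) ^ k ≤ (n : ℝ) ^ k * ((k : ℝ) + 1) ^ d := by exact_mod_cast h1
    push_cast at hk
    linarith

/-- The sums of elements of `S` in which each element occurs at most `k` times. -/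
noncomputable def boundedSums {N : Type*} [AddCommMonoid N] (S : Finset N) (k : ℕ) :
    Finset N := by
  classical
  exact (Fintype.piFinset fun _ : S => Finset.range (k + 1)).image fun c : S → ℕ =>
    ∑ s : S, c s • (s : N)

section BoundedSums

variable {N : Type*} [AddCommMonoid N] (S : Finset N)

theorem mem_boundedSums {S : Finset N} {k : ℕ} {x : N} :
    x ∈ boundedSums S k ↔ ∃ c : S → ℕ, (∀ s, c s ≤ k) ∧ ∑ s, c s • (s : N) = x := by
  simp only [boundedSums, Finset.mem_image, Fintype.mem_piFinset, Finset.mem_range,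
    Nat.lt_succ_iff]

theorem card_boundedSums_le (k : ℕ) : (boundedSums S k).card ≤ (k + 1) ^ S.card := by
  classical
  unfold boundedSums
  refine Finset.card_image_le.trans ?_
  simp

theorem one_le_card_boundedSums_zero : 1 ≤ (boundedSums S 0).card :=
  Finset.card_pos.2 ⟨0, mem_boundedSums.2 ⟨0, by simp, by simp⟩⟩

theorem add_mem_boundedSums {S : Finset N} {k : ℕ} {x s : N} (hx : x ∈ boundedSums S k)
    (hs : s ∈ S) : x + s ∈ boundedSums S (k + 1) := by
  classical
  obtain ⟨c, hc, rfl⟩ := mem_boundedSums.1 hx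
  refine mem_boundedSums.2 ⟨c + Pi.single ⟨s, hs⟩ 1, fun t => ?_, ?_⟩
  · rw [Pi.add_apply]
    refine add_le_add (hc t) ?_
    rw [Pi.single_apply]
    split_ifs <;> simp
  · simp [add_smul, Finset.sum_add_distrib, Pi.single_apply, ite_smul]

end BoundedSums

namespace AddMonoidAlgebra

section Coefficients

variable {R : Type*} [Ring R] {N : Type*} [AddCommMonoid N]

theorem coeff_mul_mem (I : Ideal R) (a : AddMonoidAlgebra R N) {b : AddMonoidAlgebra R N}
    (hb : ∀ t, b.coeff t ∈ I) (t : N) : (a * b).coeff t ∈ I := by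
  classical
  rw [coeff_mul]
  refine I.sum_mem fun s _ => I.sum_mem fun w _ => ?_
  dsimp only
  split_ifs
  · exact I.mul_mem_left _ (hb w)
  · exact I.zero_mem

/-- The left ideal of the elements with all coefficients in a given left ideal. -/
def coeffIdeal (N : Type*) [AddCommMonoid N] (I : Ideal R) : Ideal (AddMonoidAlgebra R N) where
  carrier := {a | ∀ t, a.coeff t ∈ I}
  add_mem' ha hb t := I.add_mem (ha t) (hb t)
  zero_mem' _ := I.zero_mem
  smul_mem' c _ ha := coeff_mul_mem I c ha

theorem mem_coeffIdeal {I : Ideal R} {a : AddMonoidAlgebra R N} :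
    a ∈ coeffIdeal N I ↔ ∀ t, a.coeff t ∈ I := Iff.rfl

theorem single_mem_coeffIdeal {I : Ideal R} {t : N} {x : R} :
    single t x ∈ coeffIdeal N I ↔ x ∈ I := by
  classical
  refine ⟨fun h => by simpa using h t, fun h s => ?_⟩
  rw [coeff_single, Finsupp.single_apply]
  split_ifs
  · exact h
  · exact I.zero_mem

theorem coeffIdeal_mono {I J : Ideal R} (h : I ≤ J) : coeffIdeal N I ≤ coeffIdeal N J :=
  fun _ ha t => h (ha t)

theorem coeffIdeal_injective : Function.Injective (coeffIdeal (R := R) N) := fun I J h => by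
  ext x
  rw [← single_mem_coeffIdeal (t := (0 : N)), h, single_mem_coeffIdeal]

theorem coeffIdeal_ne_bot {I : Ideal R} (hI : I ≠ ⊥) : coeffIdeal N I ≠ ⊥ := by
  obtain ⟨x, hx, hx0⟩ := Submodule.exists_mem_ne_zero_of_ne_bot hI
  exact (Submodule.ne_bot_iff _).2
    ⟨single 0 x, single_mem_coeffIdeal.2 hx, single_ne_zero.2 hx0⟩

theorem iSupIndep_coeffIdeal {ι : Type*} {f : ι → Ideal R} (hf : iSupIndep f) :
    iSupIndep fun i => coeffIdeal N (f i) := by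
  rw [iSupIndep_iff_finsetSum_eq_zero_imp_eq_zero] at hf ⊢
  intro s v hv hs i hi
  ext t
  refine hf s (fun i => (v i).coeff t) (fun i hi => hv i hi t) ?_ i hi
  have := congrArg (fun a => a.coeff t) hs
  simpa using this

theorem single_zero_mul_eq_smul (r : R) (a : AddMonoidAlgebra R N) : single 0 r * a = r • a := by
  ext t
  rw [coeff_single_zero_mul, coeff_smul_apply, smul_eq_mul]

theorem coeffIdeal_lAnnSet (U : Set R) :
    coeffIdeal N (lAnnSet R U) = lAnnSet (AddMonoidAlgebra R N) (single 0 '' U) := by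
  ext a
  simp only [mem_coeffIdeal, mem_lAnnSet, Set.forall_mem_image]
  refine ⟨fun h u hu => ?_, fun h t u hu => ?_⟩
  · ext t
    rw [coeff_mul_single_zero, h t u hu]
    simp
  · rw [← coeff_mul_single_zero, h hu]
    simp

theorem isLeftGoldie_of_isLeftGoldie (h : IsLeftGoldie (AddMonoidAlgebra R N)) :
    IsLeftGoldie R := by
  refine ⟨?_, fun f hf hmono => ?_⟩
  · rintro ⟨f, hf, h0⟩
    exact h.1 ⟨_, iSupIndep_coeffIdeal hf, fun n => coeffIdeal_ne_bot (h0 n)⟩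
  · obtain ⟨n, hn⟩ := h.2 (fun n => coeffIdeal N (f n)) (fun n => by
      obtain ⟨U, hU⟩ := hf n
      exact ⟨_, hU ▸ coeffIdeal_lAnnSet U⟩) fun i j hij => coeffIdeal_mono (hmono hij)
    exact ⟨n, fun m hm => coeffIdeal_injective (hn m hm)⟩

/-- The elements supported in a given finite set, as an `R`-submodule. -/
def supportedIn (R : Type*) [Ring R] {N : Type*} [AddCommMonoid N] (S : Finset N) :
    Submodule R (AddMonoidAlgebra R N) where
  carrier := {a | ∀ t ∉ S, a.coeff t = 0}
  add_mem' ha hb t ht := by rw [coeff_add, Finsupp.add_apply, ha t ht, hb t ht, add_zero]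
  zero_mem' _ _ := rfl
  smul_mem' r a ha t ht := by rw [coeff_smul_apply, ha t ht, smul_zero]

theorem udimLE_supportedIn {n : ℕ} (h : UdimLE (⊤ : Submodule R R) n) (S : Finset N) :
    UdimLE (supportedIn R S) (n * S.card) := by
  classical
  induction S using Finset.induction_on with
  | empty =>
    intro m v hv hvi
    by_contra! hm
    refine hvi.1 ⟨0, by simpa using hm⟩ ?_
    ext t
    exact hv _ t (by simp)
  | insert s S hs ih =>
    intro m v hv hvi
    obtain ⟨J, hJ, k, hk, hki⟩ := hvi.exists_split (supportedIn R S)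
    rw [← Fintype.card_fin m, Finset.card_insert_of_notMem hs, mul_add_one, add_comm]
    refine Fintype.card_le_of_finset_add J ?_ (ih.card_le hk hki)
    have hJ' : ∀ r : J → R, ∑ j, r j • (v j).coeff s = 0 → ∀ j, r j • v j = 0 := by
      intro r hr j
      have := hJ (fun i => if h : i ∈ J then r ⟨i, h⟩ else 0) ?_ j j.2
      · simpa using this
      · rw [← Finset.sum_coe_sort]
        simp only [Finset.coe_mem, dite_true, Subtype.coe_eta]
        intro t ht
        by_cases hts : t = s
        · simpa [hts] using hr
        · have hmem : ∑ j : J, r j • v j ∈ supportedIn R (insert s S) :=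
            Submodule.sum_mem _ fun j _ => Submodule.smul_mem _ _ (hv j)
          exact hmem t (by simp [hts, ht])
    refine h.card_le (v := fun j : J => (v j).coeff s) (fun _ => Submodule.mem_top)
      ⟨fun j h0 => hvi.1 j ?_, fun r hr j => ?_⟩
    · have h0' : (v j).coeff s = 0 := h0
      simpa using hJ' (Pi.single j 1) (by
        rw [Finset.sum_eq_single j (fun i _ hij => by simp [Pi.single_eq_of_ne hij]) (by simp),
          h0', smul_zero]) j
    · rw [← coeff_smul_apply, hJ' r hr j]
      simp

theorem exists_smul_forall_coeff_eq_zero {a : AddMonoidAlgebra R N} (ha : a ≠ 0) :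
    ∃ r : R, r • a ≠ 0 ∧ ∀ (s : R) (t : N), (r • a).coeff t ≠ 0 → s * (r • a).coeff t = 0 →
      s • r • a = 0 := by
  obtain ⟨r, hr, hmin⟩ := (measure fun r : R => (r • a).coeff.support.card).wf.has_min
    {r | r • a ≠ 0} ⟨1, by simpa using ha⟩
  refine ⟨r, hr, fun s t ht hst => ?_⟩
  by_contra h
  refine hmin (s * r) (by simpa [mul_smul] using h) (Finset.card_lt_card ?_)
  rw [Finset.ssubset_iff_of_subset]
  · exact ⟨t, by simpa using ht, by simpa [mul_assoc] using hst⟩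
  · intro w hw
    simp only [Finsupp.mem_support_iff, coeff_smul_apply, smul_eq_mul, mul_assoc] at hw ⊢
    exact right_ne_zero_of_mul hw

theorem smul_single_one_mul (r : R) (t : N) (a : AddMonoidAlgebra R N) :
    r • (single t 1 * a) = single t r * a := by
  rw [← single_zero_mul_eq_smul, ← mul_assoc, single_mul_single, zero_add, mul_one]

theorem smul_mem_twoSidedIdeal {I : TwoSidedIdeal (AddMonoidAlgebra R N)} (r : R)
    {a : AddMonoidAlgebra R N} (ha : a ∈ I) : r • a ∈ I := by
  rw [← single_zero_mul_eq_smul]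
  exact I.mul_mem_left _ _ ha

theorem _root_.TwoSidedIdeal.exists_mem_ne_zero {A : Type*} [Ring A] {I : TwoSidedIdeal A}
    (hI : I ≠ ⊥) : ∃ a ∈ I, a ≠ 0 := by
  by_contra! H
  exact hI (le_bot_iff.1 fun a ha => (TwoSidedIdeal.mem_bot A).2 (H a ha))

theorem exists_coeff_ne_zero_forall_le [LinearOrder N] {a : AddMonoidAlgebra R N} (ha : a ≠ 0) :
    ∃ t, a.coeff t ≠ 0 ∧ ∀ s, a.coeff s ≠ 0 → s ≤ t := by
  have hne : a.coeff.support.Nonempty := by simpa using ha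
  exact ⟨a.coeff.support.max' hne, Finsupp.mem_support_iff.1 (Finset.max'_mem _ _),
    fun s hs => Finset.le_max' _ _ (Finsupp.mem_support_iff.2 hs)⟩

end Coefficients

section Ordered

variable {R : Type u} [Ring R] {N : Type v} [AddCommMonoid N] [LinearOrder N]
  [IsOrderedCancelAddMonoid N]

theorem coeff_mul_add_of_forall_le {a b : AddMonoidAlgebra R N} {t u : N}
    (H : ∀ s w, a.coeff s * b.coeff w ≠ 0 → s ≤ t ∧ w ≤ u) :
    (a * b).coeff (t + u) = a.coeff t * b.coeff u := by
  have key : ∀ s w, (s, w) ≠ (t, u) →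
      (if s + w = t + u then a.coeff s * b.coeff w else 0) = 0 := by
    intro s w hne
    split_ifs with he
    · by_contra h
      obtain ⟨h1, h2⟩ := H s w h
      rcases h1.lt_or_eq with h1 | rfl
      · exact (add_lt_add_of_lt_of_le h1 h2).ne he
      · exact hne (by rw [add_left_cancel he])
    · rfl
  rw [coeff_mul, Finsupp.sum, Finset.sum_eq_single t, Finsupp.sum, Finset.sum_eq_single u]
  · simp
  · exact fun w _ hw => key t w (by simp [hw])
  · intro hu
    simp [Finsupp.notMem_support_iff.1 hu]
  · exact fun s _ hs => Finset.sum_eq_zero fun w _ => key s w (by simp [hs])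
  · intro ht
    simp [Finsupp.notMem_support_iff.1 ht]

theorem coeff_mul_add_top {a b : AddMonoidAlgebra R N} {t u : N}
    (ht : ∀ s, a.coeff s ≠ 0 → s ≤ t) (hu : ∀ s, b.coeff s ≠ 0 → s ≤ u) :
    (a * b).coeff (t + u) = a.coeff t * b.coeff u :=
  coeff_mul_add_of_forall_le fun s w h =>
    ⟨ht s (left_ne_zero_of_mul h), hu w (right_ne_zero_of_mul h)⟩

theorem coeff_mul_mul_coeff_eq_zero {a b : AddMonoidAlgebra R N} {t u : N}
    (ht : ∀ s, a.coeff s ≠ 0 → s ≤ t) (hu : ∀ s, b.coeff s ≠ 0 → s ≤ u) (r : R)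
    (h : a * (r • b) = 0) : a.coeff t * r * b.coeff u = 0 := by
  rw [mul_assoc, ← smul_eq_mul r, ← coeff_smul_apply, ← coeff_mul_add_top ht, h]
  · simp
  · intro s hs
    rw [coeff_smul_apply, smul_eq_mul] at hs
    exact hu s (right_ne_zero_of_mul hs)

theorem isSemiprimeRing (hR : IsSemiprimeRing R) : IsSemiprimeRing (AddMonoidAlgebra R N) := by
  intro I hI
  by_contra hne
  obtain ⟨a, ha, ha0⟩ := TwoSidedIdeal.exists_mem_ne_zero hne
  obtain ⟨t, ht0, ht⟩ := exists_coeff_ne_zero_forall_le ha0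
  exact ht0 (hR.eq_zero fun r =>
    coeff_mul_mul_coeff_eq_zero ht ht r (hI a ha _ (smul_mem_twoSidedIdeal r ha)))

theorem isPrimeRing (hR : IsPrimeRing R) : IsPrimeRing (AddMonoidAlgebra R N) := by
  intro I J hIJ
  by_contra! hne
  obtain ⟨a, ha, ha0⟩ := TwoSidedIdeal.exists_mem_ne_zero hne.1
  obtain ⟨b, hb, hb0⟩ := TwoSidedIdeal.exists_mem_ne_zero hne.2
  obtain ⟨t, ht0, ht⟩ := exists_coeff_ne_zero_forall_le ha0
  obtain ⟨u, hu0, hu⟩ := exists_coeff_ne_zero_forall_le hb0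
  exact (hR.eq_zero_or_eq_zero fun r => coeff_mul_mul_coeff_eq_zero ht hu r
    (hIJ a ha _ (smul_mem_twoSidedIdeal r hb))).elim ht0 hu0

theorem singSet_eq_zero (hR : ∀ x ∈ singSet R, x = 0) :
    ∀ a ∈ singSet (AddMonoidAlgebra R N), a = 0 := by
  intro a ha
  by_contra ha0
  obtain ⟨t, ht0, ht⟩ := exists_coeff_ne_zero_forall_le ha0
  refine ht0 (hR _ fun K hK hinf => ?_)
  obtain ⟨p, hp, hp0⟩ := Submodule.exists_mem_ne_zero_of_ne_bot
    (ha (coeffIdeal N K) (coeffIdeal_ne_bot hK))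
  obtain ⟨s, hs0, hs⟩ := exists_coeff_ne_zero_forall_le hp0
  refine hs0 ((Submodule.mem_bot R).1 (hinf ▸ ⟨?_, hp.2 s⟩))
  rw [SetLike.mem_coe, mem_lAnn, ← coeff_mul_add_top hs ht, mem_lAnn.1 hp.1]
  simp

theorem coeff_smul_eq_zero_of_mul_eq_zero {b : AddMonoidAlgebra R N}
    (hb : ∀ (s : R) (t : N), b.coeff t ≠ 0 → s * b.coeff t = 0 → s • b = 0)
    {p : AddMonoidAlgebra R N} (hp : p * b = 0) (t : N) : p.coeff t • b = 0 := by
  classical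
  by_contra hne
  have hb0 : b ≠ 0 := by
    rintro rfl
    exact hne (smul_zero _)
  obtain ⟨u, hu0, hu⟩ := exists_coeff_ne_zero_forall_le hb0
  obtain ⟨t₀, ht₀, hmax⟩ :=
    (p.coeff.support.filter fun t => p.coeff t • b ≠ 0).exists_max_image id ⟨t, by
      rw [Finset.mem_filter, Finsupp.mem_support_iff]
      refine ⟨fun h => hne ?_, hne⟩
      rw [h, zero_smul]⟩
  refine (Finset.mem_filter.1 ht₀).2 (hb _ u hu0 ?_)
  rw [← coeff_mul_add_of_forall_le, hp]
  · simp
  · refine fun s w h => ⟨hmax s (Finset.mem_filter.2 ⟨?_, fun h0 => h ?_⟩),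
      hu w (right_ne_zero_of_mul h)⟩
    · exact Finsupp.mem_support_iff.2 (left_ne_zero_of_mul h)
    · rw [← smul_eq_mul, ← coeff_smul_apply, h0]
      simp

theorem udimLE_top {n : ℕ} (h : UdimLE (⊤ : Submodule R R) n) :
    UdimLE (⊤ : Submodule (AddMonoidAlgebra R N) (AddMonoidAlgebra R N)) n := by
  classical
  intro m v _ hv
  by_contra! hnm
  choose r hr0 hr using fun i => exists_smul_forall_coeff_eq_zero (hv.1 i)
  set b : Fin m → AddMonoidAlgebra R N := fun i => r i • v i with hb
  have hbi : IndepCyclic (AddMonoidAlgebra R N) b := by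
    have := hv.smul (r := fun i => single 0 (r i)) (by
      simpa only [smul_eq_mul, single_zero_mul_eq_smul] using hr0)
    simpa only [smul_eq_mul, single_zero_mul_eq_smul] using this
  set S : Finset N := Finset.univ.biUnion fun i => (b i).coeff.support with hS
  refine not_forall_mul_le_of_le_succ_pow hnm (one_le_card_boundedSums_zero S)
    (card_boundedSums_le S) fun k => ?_
  have := (udimLE_supportedIn h (boundedSums S (k + 1))).card_le
    (v := fun x : Fin m × boundedSums S k => single (x.2 : N) 1 * b x.1) ?_ ?_
  · simpa using this
  · rintro ⟨i, t⟩ x hx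
    by_contra hne
    obtain ⟨u, hu, rfl⟩ := Finset.mem_image.1
      (support_coeff_single_mul_subset _ _ _ (Finsupp.mem_support_iff.2 hne))
    exact hx (add_mem_boundedSums t.2 (Finset.mem_biUnion.2 ⟨i, Finset.mem_univ i, hu⟩))
  · have hzero : ∀ (c : Fin m × boundedSums S k → R) (x : Fin m × boundedSums S k),
        c x • b x.1 = 0 → c x • (single (x.2 : N) 1 * b x.1) = 0 := by
      intro c x hx
      rw [smul_single_one_mul, ← one_mul (c x), ← add_zero (x.2 : N), ← single_mul_single,
        mul_assoc, single_zero_mul_eq_smul, hx, mul_zero]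
    refine ⟨?_, fun c hc x => hzero c x ?_⟩
    · rintro ⟨i, t⟩ h0
      exact hbi.1 i (by simpa using coeff_smul_eq_zero_of_mul_eq_zero (hr i) h0 t)
    · let p : Fin m → AddMonoidAlgebra R N := fun i =>
        ∑ t : boundedSums S k, single (t : N) (c (i, t))
      have hsum : ∑ i, p i • b i = 0 := by
        rw [← hc, Fintype.sum_prod_type]
        simp only [p, smul_eq_mul, Finset.sum_mul, smul_single_one_mul]
      have hcoeff : (p x.1).coeff x.2 = c x := by
        simp [p, Finsupp.single_apply]
      rw [← hcoeff]
      exact coeff_smul_eq_zero_of_mul_eq_zero (hr x.1) (hbi.2 p hsum x.1) _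

theorem isLeftGoldie (hR : IsSemiprimeRing R) (h : IsLeftGoldie R) :
    IsLeftGoldie (AddMonoidAlgebra R N) := by
  obtain ⟨n, hn⟩ := exists_udimLE_of_not_exists_iSupIndep h.1
  have := (udimLE_top (N := N) hn).not_exists_iSupIndep
  exact ⟨this, accLeftAnnihilators_of_singSet (singSet_eq_zero (hR.singSet_eq_zero h.2)) this⟩

theorem udim_eq {N : Type u} [AddCommMonoid N] [LinearOrder N] [IsOrderedCancelAddMonoid N]
    (h : IsLeftGoldie R) :
    udim (AddMonoidAlgebra R N) (AddMonoidAlgebra R N) = udim R R := by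
  obtain ⟨n, hn⟩ := exists_udimLE_of_not_exists_iSupIndep h.1
  obtain ⟨m, hm, v, hv⟩ := hn.exists_indepCyclic
  rw [udim_eq_of_udimLE hm hv, udim_eq_of_udimLE (udimLE_top hm)
    (IndepCyclic.of_iSupIndep (iSupIndep_coeffIdeal (N := N) hv.iSupIndep)
      (v := fun i => single 0 (v i))
      (fun i => single_mem_coeffIdeal.2 (Submodule.mem_span_singleton_self _))
      fun i => single_ne_zero.2 (hv.1 i))]

end Ordered

end AddMonoidAlgebra

theorem exists_linearOrder_isOrderedCancelAddMonoid {N L : Type*} [AddCommMonoid N]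
    [AddCommMonoid L] [LinearOrder L] [IsOrderedCancelAddMonoid L] (e : N →+ L)
    (he : Function.Injective e) : ∃ _ : LinearOrder N, IsOrderedCancelAddMonoid N :=
  let : LinearOrder N := LinearOrder.lift' e he
  ⟨this, Function.Injective.isOrderedCancelAddMonoid e (map_add e) Iff.rfl⟩

/-- Let `R` be a semiprime (resp. prime) ring, `T` an additive submonoid
of the free abelian group `σ →₀ ℤ`, and `A = AddMonoidAlgebra R T`. Then `R` is left
Goldie iff `A` is; in that case `A` is semiprime (resp. prime) and `udim A = udim R`. -/
theorem stmt_16 {R : Type u} [Ring R] {σ : Type u} (T : AddSubmonoid (σ →₀ ℤ)) :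
    (IsSemiprimeRing R →
      (IsLeftGoldie R ↔ IsLeftGoldie (AddMonoidAlgebra R T)) ∧
      (IsLeftGoldie R →
        IsSemiprimeRing (AddMonoidAlgebra R T) ∧
        udim (AddMonoidAlgebra R T) (AddMonoidAlgebra R T) = udim R R)) ∧
    (IsPrimeRing R →
      (IsLeftGoldie R ↔ IsLeftGoldie (AddMonoidAlgebra R T)) ∧
      (IsLeftGoldie R →
        IsPrimeRing (AddMonoidAlgebra R T) ∧
        udim (AddMonoidAlgebra R T) (AddMonoidAlgebra R T) = udim R R)) := by
  classical
  let : LinearOrder σ := linearOrderOfSTO WellOrderingRel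
  let e : T →+ Lex (σ →₀ ℤ) := { toFun t := toLex t, map_zero' := rfl, map_add' _ _ := rfl }
  obtain ⟨_, _⟩ := exists_linearOrder_isOrderedCancelAddMonoid e
    (toLex.injective.comp Subtype.val_injective)
  have goldie : IsSemiprimeRing R → (IsLeftGoldie R ↔ IsLeftGoldie (AddMonoidAlgebra R T)) :=
    fun hR => ⟨AddMonoidAlgebra.isLeftGoldie hR, AddMonoidAlgebra.isLeftGoldie_of_isLeftGoldie⟩
  exact ⟨fun hR => ⟨goldie hR, fun h =>
      ⟨AddMonoidAlgebra.isSemiprimeRing hR, AddMonoidAlgebra.udim_eq h⟩⟩,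
    fun hR => ⟨goldie hR.isSemiprimeRing, fun h =>
      ⟨AddMonoidAlgebra.isPrimeRing hR, AddMonoidAlgebra.udim_eq h⟩⟩⟩
end

section
/- Let p be a prime, e ≥ 2, r ≥ 2, and let R be a ring of characteristic p^{r+1} (CharP R (p^{r+1})). Let α be the unique ring endomorphism of the polynomial ring R[X] that fixes constant polynomials and sends X to X + p·X^e. Then α is a ring automorphism of R[X] of order exactly p^r: α^{p^r} is the identity, while α^m(X) ≠ X for every m with 1 ≤ m < p^r. Moreover α(X^{p^r}) = X^{p^r}. -/
open Polynomial

/-- An additive endomorphism congruent to the identity modulo `q` has its iterates congruent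
modulo `q ^ 2` to their first-order expansions. -/
theorem AddMonoidHom.exists_iterate_eq_add_nsmul {A : Type*} [AddCommGroup A] (β : A →+ A)
    (q : ℕ) (h : ∀ f, ∃ g, β f = f + q • g) {f g : A} (hg : β f = f + q • g) (m : ℕ) :
    ∃ z, (⇑β)^[m] f = f + (m * q) • g + (q * q) • z := by
  induction m with
  | zero => exact ⟨0, by simp⟩
  | succ m ih =>
    obtain ⟨z, hz⟩ := ih
    obtain ⟨g', hg'⟩ := h g
    refine ⟨m • g' + β z, ?_⟩
    rw [Function.iterate_succ_apply', hz]
    simp only [map_add, map_nsmul, hg, hg']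
    module

/-- If an additive endomorphism is congruent to the identity modulo `p`, then its `p ^ k`-th
iterate is congruent to the identity modulo `p ^ (k + 1)`. -/
theorem AddMonoidHom.exists_iterate_pow_eq_add_nsmul {A : Type*} [AddCommGroup A] (β : A →+ A)
    (p : ℕ) (h : ∀ f, ∃ g, β f = f + p • g) (k : ℕ) (f : A) :
    ∃ g, (⇑β)^[p ^ k] f = f + p ^ (k + 1) • g := by
  induction k generalizing f with
  | zero => simpa using h f
  | succ k ih =>
    obtain ⟨γ, hγ⟩ : ∃ γ : A →+ A, ⇑γ = (⇑β)^[p ^ k] :=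
      ⟨AddMonoidHom.mk' _ (iterate_map_add β (p ^ k)), rfl⟩
    rw [← hγ] at ih
    obtain ⟨g, hg⟩ := ih f
    obtain ⟨z, hz⟩ := γ.exists_iterate_eq_add_nsmul _ ih hg p
    refine ⟨g + p ^ k • z, ?_⟩
    rw [pow_succ p k, Function.iterate_mul, ← hγ, hz]
    module

/-- In characteristic `p ^ (r + 1)`, every `1 + p • y` is a `p ^ r`-th root of unity. -/
theorem CharP.one_add_nsmul_pow_eq_one {A : Type*} [Ring A] (p r : ℕ)
    [CharP A (p ^ (r + 1))] (y : A) : (1 + p • y) ^ p ^ r = 1 := by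
  obtain ⟨g, hg⟩ := (AddMonoidHom.mulLeft (1 + p • y)).exists_iterate_pow_eq_add_nsmul p
    (fun f => ⟨y * f, by simp [add_mul, mul_assoc]⟩) r 1
  have hc : (⇑(AddMonoidHom.mulLeft (1 + p • y)))^[p ^ r] 1 = (1 + p • y) ^ p ^ r := by
    simp [AddMonoidHom.coe_mulLeft, mul_left_iterate]
  rw [← hc, hg, nsmul_eq_mul, CharP.cast_eq_zero, zero_mul, add_zero]

namespace Polynomial

variable {R : Type*} [Ring R]

theorem X_add_nsmul_X_pow_eq_X_mul {e : ℕ} (he : e ≠ 0) (p : ℕ) :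
    (X + p • X ^ e : R[X]) = X * (1 + p • X ^ (e - 1)) := by
  obtain ⟨d, rfl⟩ := Nat.exists_eq_succ_of_ne_zero he
  rw [Nat.succ_sub_one, mul_add, mul_one, mul_smul_comm, ← pow_succ']

theorem exists_map_eq_add_nsmul (p : ℕ) (α : R[X] →+* R[X]) (hC : ∀ a : R, α (C a) = C a)
    {y : R[X]} (hX : α X = X + p • y) (f : R[X]) : ∃ g, α f = f + p • g := by
  induction f using Polynomial.induction_on with
  | C a => exact ⟨0, by simp [hC]⟩
  | add f₁ f₂ h₁ h₂ =>
    obtain ⟨g₁, h₁⟩ := h₁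
    obtain ⟨g₂, h₂⟩ := h₂
    exact ⟨g₁ + g₂, by rw [map_add, h₁, h₂]; module⟩
  | monomial n a h =>
    obtain ⟨g, hg⟩ := h
    refine ⟨C a * X ^ n * y + g * X + p • (g * y), ?_⟩
    rw [pow_succ, ← mul_assoc, map_mul, hg, hX]
    simp only [add_mul, mul_add, smul_mul_assoc, mul_smul_comm]
    module

/-- The `m`-th iterate of `X ↦ X + p • X ^ e` sends `X` to `X + (m * p) • X ^ e` modulo
`X ^ (e + 1)`. -/
theorem exists_iterate_X_eq_add (p e : ℕ) (he : 2 ≤ e) (α : R[X] →+* R[X])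
    (hX : α X = X + p • X ^ e) (m : ℕ) :
    ∃ g, (⇑α)^[m] X = X + (m * p) • X ^ e + X ^ (e + 1) * g := by
  set u : R[X] := 1 + p • X ^ (e - 1) with hu
  have hXu : α X = X * u := by rw [hX, X_add_nsmul_X_pow_eq_X_mul (by omega)]
  have hXpow (n : ℕ) : α (X ^ n) = X ^ n * u ^ n := by
    rw [map_pow, hXu, (commute_X u).mul_pow]
  have hu0 : constantCoeff u = 1 := by
    simp [hu, show 0 ≠ e - 1 by omega, coeff_X_pow]
  obtain ⟨s, hs⟩ : X ∣ u ^ e - 1 := by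
    rw [X_dvd_iff, ← constantCoeff_apply, map_sub, map_pow, hu0]
    simp
  rw [sub_eq_iff_eq_add'] at hs
  induction m with
  | zero => exact ⟨0, by simp⟩
  | succ m ih =>
    obtain ⟨g, hg⟩ := ih
    refine ⟨(m * p) • s + u ^ (e + 1) * α g, ?_⟩
    rw [Function.iterate_succ_apply', hg, map_add, map_add, map_nsmul, map_mul, hXpow, hXpow, hX,
      hs]
    simp only [mul_add, mul_one, mul_smul_comm, ← mul_assoc, ← pow_succ]
    module

end Polynomial

/-- Let `p` be a prime, `e, r ≥ 2`, `R` a ring of characteristic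
`p^(r+1)`, and `α` the ring endomorphism of `R[X]` fixing constants and sending `X` to
`X + p·X^e`. Then `α` is an automorphism of order exactly `p^r` (it has `α^[p^r] = id`
while `α^[m] X ≠ X` for `1 ≤ m < p^r`), and `α (X^(p^r)) = X^(p^r)`. -/
theorem stmt_18 {R : Type u} [Ring R] (p e r : ℕ) (hp : p.Prime) (he : 2 ≤ e)
    (hr : 2 ≤ r) [CharP R (p ^ (r + 1))]
    (α : Polynomial R →+* Polynomial R)
    (hC : ∀ a : R, α (C a) = C a)
    (hX : α X = X + p • X ^ e) :
    Function.Bijective α ∧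
    (⇑α)^[p ^ r] = id ∧
    (∀ m : ℕ, 1 ≤ m → m < p ^ r → (⇑α)^[m] (X : Polynomial R) ≠ X) ∧
    α (X ^ p ^ r) = X ^ p ^ r := by
  have hid : (⇑α)^[p ^ r] = id := by
    funext f
    obtain ⟨g, hg⟩ := α.toAddMonoidHom.exists_iterate_pow_eq_add_nsmul p
      (exists_map_eq_add_nsmul p α hC hX) r f
    rw [nsmul_eq_mul, CharP.cast_eq_zero, zero_mul, add_zero] at hg
    exact hg
  refine ⟨?_, hid, ?_, ?_⟩
  · have hbij : Function.Bijective (⇑α)^[p ^ r] := hid ▸ Function.bijective_id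
    obtain ⟨n, hn⟩ := Nat.exists_eq_succ_of_ne_zero (pow_pos hp.pos r).ne'
    rw [hn] at hbij
    refine ⟨Function.Injective.of_comp (f := (⇑α)^[n]) ?_,
      Function.Surjective.of_comp (g := (⇑α)^[n]) ?_⟩
    · rw [← Function.iterate_succ]
      exact hbij.1
    · rw [← Function.iterate_succ']
      exact hbij.2
  · intro m hm hmr h
    obtain ⟨g, hg⟩ := exists_iterate_X_eq_add p e he α hX m
    rw [h] at hg
    have hcoeff : ((m * p : ℕ) : R) = 0 := by
      have := congrArg (fun f => coeff f e) hg
      simp only [coeff_add, coeff_smul, coeff_X_pow_self, coeff_X_pow_mul', nsmul_one] at this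
      simpa using this
    rw [CharP.cast_eq_zero_iff R (p ^ (r + 1)), pow_succ] at hcoeff
    exact absurd (Nat.le_of_dvd hm (Nat.dvd_of_mul_dvd_mul_right hp.pos hcoeff)) (by omega)
  · rw [map_pow, hX, X_add_nsmul_X_pow_eq_X_mul (by omega), (commute_X _).mul_pow,
      CharP.one_add_nsmul_pow_eq_one, mul_one]
end

section
/- Let e ≥ 2 be an integer and let Γ_e be the monoid presented by two generators x, y subject to the single relation y·x = x^e·y, i.e., the quotient of the free monoid on {x, y} by the monoid congruence generated by the pair (y·x, x^e·y). Then the submonoid of Γ_e generated by the elements x·y and x²·y is free on these two elements; equivalently, the monoid homomorphism from the free monoid on two letters u, v to Γ_e determined by u ↦ x·y and v ↦ x²·y is injective. -/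
lemma Function.End.mul_apply {α : Type*} (f g : Function.End α) (a : α) :
    (f * g) a = f (g a) := rfl

lemma Function.End.one_apply {α : Type*} (a : α) : (1 : Function.End α) a = a := rfl

/-- The letters act on `ℕ` by `n ↦ n + 1` and `n ↦ e * n`. -/
def affineAction (e : ℕ) : FreeMonoid (Fin 2) →* Function.End ℕ :=
  FreeMonoid.lift fun i n => (if i = 0 then n + 1 else e * n : ℕ)

lemma affineAction_of_zero (e n : ℕ) : affineAction e (FreeMonoid.of 0) n = n + 1 := by
  exact congrFun (FreeMonoid.lift_eval_of (M := Function.End ℕ) _ _) n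

lemma affineAction_of_one (e n : ℕ) : affineAction e (FreeMonoid.of 1) n = e * n := by
  exact congrFun (FreeMonoid.lift_eval_of (M := Function.End ℕ) _ _) n

lemma affineAction_of_zero_pow (e k n : ℕ) :
    affineAction e (FreeMonoid.of 0 ^ k) n = n + k := by
  induction k generalizing n with
  | zero => rw [pow_zero, map_one, Function.End.one_apply, add_zero]
  | succ k ih =>
    rw [pow_succ, map_mul, Function.End.mul_apply, ih, affineAction_of_zero]
    omega

/-- Words in the digits `1` and `2` are determined by their value in base `e ≥ 2`. -/
lemma lift_digits_apply_zero_injective {e : ℕ} (he : 2 ≤ e) {M : Type*} [Monoid M]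
    (φ : M →* Function.End ℕ) (g : Fin 2 → M)
    (hg : ∀ i n, φ (g i) n = e * n + (i.val + 1)) :
    Function.Injective fun w => φ (FreeMonoid.lift g w) 0 := by
  have cons (i : Fin 2) (w : FreeMonoid (Fin 2)) :
      φ (FreeMonoid.lift g (FreeMonoid.of i * w)) 0 =
        e * φ (FreeMonoid.lift g w) 0 + (i.val + 1) := by
    rw [map_mul, map_mul, FreeMonoid.lift_eval_of, Function.End.mul_apply, hg]
  have nil : φ (FreeMonoid.lift g 1) 0 = 0 := by
    rw [map_one, map_one, Function.End.one_apply]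
  intro v
  induction v using FreeMonoid.inductionOn' with
  | one =>
    intro w h
    cases w using FreeMonoid.casesOn with
    | one => rfl
    | of_mul j w => simp only [cons, nil] at h; omega
  | of_mul i v ih =>
    intro w h
    cases w using FreeMonoid.casesOn with
    | one => simp only [cons, nil] at h; omega
    | of_mul j w =>
      simp only [cons] at h
      have key : ∀ a b : ℕ, e * a + 1 ≠ e * b + 2 := by
        intro a b hab
        have : e ∣ 1 := (Nat.dvd_add_right (dvd_mul_right e b)).mp
          (show e ∣ e * b + 1 from ⟨a, by omega⟩)
        exact absurd (Nat.le_of_dvd one_pos this) (by omega)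
      have hij : i = j := by
        fin_cases i <;> fin_cases j
        · rfl
        · exact absurd h (key _ _)
        · exact absurd h.symm (key _ _)
        · rfl
      subst hij
      rw [ih (Nat.eq_of_mul_eq_mul_left (by omega) (Nat.add_right_cancel h))]

/-- Let `e ≥ 2` and let `Γ_e` be the monoid presented by generators
`x, y` and the single relation `y·x = x^e·y`, i.e. the quotient of the free monoid on two
letters by the monoid congruence generated by that pair. Then the monoid homomorphism from
the free monoid on two letters to `Γ_e` sending the first letter to `x·y` and the second
to `x²·y` is injective (so `x·y` and `x²·y` freely generate a free submonoid). -/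
theorem stmt_19 (e : ℕ) (he : 2 ≤ e) :
    Function.Injective
      ⇑(FreeMonoid.lift (fun i : Fin 2 =>
        (conGen (fun a b : FreeMonoid (Fin 2) =>
            a = FreeMonoid.of 1 * FreeMonoid.of 0 ∧
            b = FreeMonoid.of 0 ^ e * FreeMonoid.of 1)).mk'
          (if i = 0 then FreeMonoid.of 0 * FreeMonoid.of 1
           else FreeMonoid.of 0 ^ 2 * FreeMonoid.of 1))) := by
  set r : FreeMonoid (Fin 2) → FreeMonoid (Fin 2) → Prop := fun a b =>
    a = FreeMonoid.of 1 * FreeMonoid.of 0 ∧ b = FreeMonoid.of 0 ^ e * FreeMonoid.of 1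
  have hr : conGen r ≤ Con.ker (affineAction e) := by
    rw [Con.conGen_le]
    rintro _ _ ⟨rfl, rfl⟩
    rw [Con.ker_rel]
    funext n
    rw [map_mul, map_mul, Function.End.mul_apply, Function.End.mul_apply,
      affineAction_of_zero_pow, affineAction_of_zero, affineAction_of_one,
      affineAction_of_one, mul_add, mul_one]
  refine Function.Injective.of_comp (f := fun q => (conGen r).lift (affineAction e) hr q 0)
    (lift_digits_apply_zero_injective he _ _ fun i n => ?_)
  rw [Con.lift_mk']
  split_ifs with hi
  · simp [hi, Function.End.mul_apply, affineAction_of_zero, affineAction_of_one]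
  · have hi : i = 1 := by omega
    rw [map_mul, Function.End.mul_apply, affineAction_of_zero_pow,
      affineAction_of_one, hi]
    rfl
end
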